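/- arXiv:0906.3749 — 2 statements merged into one kernel-verified Lean document; each statement's English description precedes it below -/
import Mathlib

section
/- The 2-state 4-symbol Turing machine M with transition table δ(A,0)=(1,R,B), δ(A,1)=(2,L,A), δ(A,2)=(1,R,A), δ(A,3)=(1,R,A), δ(B,0)=(1,L,B), δ(B,1)=(1,L,A), δ(B,2)=(3,R,B), δ(B,3)=(1,R,H), started in state A on the all-blank tape, halts after exactly 3,932,964 steps leaving exactly 2,050 non-blank cells on the tape; consequently S(2,4) ≥ 3,932,964 and Σ(2,4) ≥ 2,050. -/
/-- Move direction of the tape head. -/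
inductive Dir : Type
  | L
  | R

/-- The head displacement of a direction. -/
def Dir.move : Dir → ℤ
  | Dir.L => -1
  | Dir.R => 1

/-- A Turing machine with `n` states and `k` symbols, in Rado's busy beaver model.
States are `Fin n` (state `A` is `0`, `B` is `1`, ...), symbols are `Fin k` with `0`
the blank symbol. A transition yields the written symbol, the move direction and the
next state, where `none` denotes the halting state `H`. -/
abbrev Machine (n k : ℕ) : Type :=
  Fin n → Fin k → Fin k × Dir × Option (Fin n)

/-- A configuration: current state (`none` = halted), head position, tape. -/
structure Cfg (n k : ℕ) where
  state : Option (Fin n)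
  pos : ℤ
  tape : ℤ → Fin k

/-- One computation step (halted configurations are fixed). -/
def step {n k : ℕ} (M : Machine n k) (c : Cfg n k) : Cfg n k :=
  match c.state with
  | none => c
  | some q =>
      { state := (M q (c.tape c.pos)).2.2
        pos := c.pos + (M q (c.tape c.pos)).2.1.move
        tape := Function.update c.tape c.pos (M q (c.tape c.pos)).1 }

/-- The initial configuration: state `A`, head at cell `0`, all-blank tape. -/
def init (n k : ℕ) [NeZero k] : Cfg n k :=
  { state := if h : 0 < n then some ⟨0, h⟩ else none
    pos := 0
    tape := fun _ => 0 }

/-- `HaltsIn M c t`: started from `c`, the machine `M` halts after exactly `t` steps. -/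
def HaltsIn {n k : ℕ} (M : Machine n k) (c : Cfg n k) (t : ℕ) : Prop :=
  ((step M)^[t] c).state = none ∧ ∀ i < t, ((step M)^[i] c).state ≠ none

/-- The number of non-blank cells of a configuration. -/
noncomputable def sigmaCount {n k : ℕ} [NeZero k] (c : Cfg n k) : ℕ :=
  Set.ncard {i : ℤ | c.tape i ≠ 0}

/-- Rado's condition: every transition into the halting state writes `1` and moves right. -/
def Valid {n k : ℕ} [NeZero k] (M : Machine n k) : Prop :=
  ∀ q a, (M q a).2.2 = none → (M q a).1 = 1 ∧ (M q a).2.1 = Dir.R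

/-- The busy beaver step function `S(n,k)`: the maximum number of steps of a halting
`n`-state `k`-symbol machine started on the all-blank tape. -/
noncomputable def bbS (n k : ℕ) [NeZero k] : ℕ :=
  sSup {t : ℕ | ∃ M : Machine n k, Valid M ∧ HaltsIn M (init n k) t}

/-- The busy beaver score function `Σ(n,k)`: the maximum number of non-blank cells left
by a halting `n`-state `k`-symbol machine started on the all-blank tape. -/
noncomputable def bbSigma (n k : ℕ) [NeZero k] : ℕ :=
  sSup {m : ℕ | ∃ M : Machine n k, Valid M ∧
    ∃ t : ℕ, HaltsIn M (init n k) t ∧ sigmaCount ((step M)^[t] (init n k)) = m}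

/-- Terry and Shawn Ligocki's 2-state 4-symbol champion machine
(states `A,B` are `0,1`; `none` is the halting state `H`). -/
def M : Machine 2 4 :=
  ![![(1, Dir.R, some 1), (2, Dir.L, some 0), (1, Dir.R, some 0), (1, Dir.R, some 0)],
    ![(1, Dir.L, some 1), (1, Dir.L, some 0), (3, Dir.R, some 1), (1, Dir.R, none)]]

/-- The configuration with head at `p`, whose tape reads `l` (outwards) to the left of the head
and `r` from the head on, with blanks elsewhere. -/
def zipper (p : ℤ) (q : Option (Fin 2)) (l r : List (Fin 4)) : Cfg 2 4 where
  state := q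
  pos := p
  tape i := if i < p then l.getD (p - 1 - i).toNat 0 else r.getD (i - p).toNat 0

/-- From the tape `l`, `r` in state `q`, the machine `M` reaches the tape `l'`, `r'` in state `q'`
after `t` steps, up to translation. -/
def Evolves (t : ℕ) (q : Option (Fin 2)) (l r : List (Fin 4))
    (q' : Option (Fin 2)) (l' r' : List (Fin 4)) : Prop :=
  ∀ p, ∃ p', (step M)^[t] (zipper p q l r) = zipper p' q' l' r'

theorem Evolves.trans {s t : ℕ} {q₁ q₂ q₃ : Option (Fin 2)} {l₁ l₂ l₃ r₁ r₂ r₃ : List (Fin 4)}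
    (h₁ : Evolves s q₁ l₁ r₁ q₂ l₂ r₂) (h₂ : Evolves t q₂ l₂ r₂ q₃ l₃ r₃) :
    Evolves (s + t) q₁ l₁ r₁ q₃ l₃ r₃ := by
  intro p
  obtain ⟨p₁, e₁⟩ := h₁ p
  obtain ⟨p₂, e₂⟩ := h₂ p₁
  exact ⟨p₂, by rw [Nat.add_comm, Function.iterate_add_apply, e₁, e₂]⟩

theorem Evolves.cast {s t : ℕ} {q₁ q₂ : Option (Fin 2)} {l₁ l₂ r₁ r₂ : List (Fin 4)}
    (h : Evolves s q₁ l₁ r₁ q₂ l₂ r₂) (e : s = t) : Evolves t q₁ l₁ r₁ q₂ l₂ r₂ :=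
  e ▸ h

theorem Evolves.refl (q : Option (Fin 2)) (l r : List (Fin 4)) : Evolves 0 q l r q l r :=
  fun p => ⟨p, rfl⟩

theorem zipper_nil (p : ℤ) (q : Option (Fin 2)) (l : List (Fin 4)) :
    zipper p q l [] = zipper p q l [0] := by
  simp only [zipper, Cfg.mk.injEq, true_and]
  funext i
  split_ifs
  · rfl
  · rcases (i - p).toNat with _ | k <;> simp

theorem step_right {q : Fin 2} {a b : Fin 4} {q' : Option (Fin 2)}
    (h : M q a = (b, Dir.R, q')) (l r : List (Fin 4)) :
    Evolves 1 (some q) l (a :: r) q' (b :: l) r := by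
  intro p
  refine ⟨p + 1, ?_⟩
  have ha : (zipper p (some q) l (a :: r)).tape p = a := by simp [zipper]
  simp only [Function.iterate_one, step]
  change Cfg.mk _ _ _ = _
  simp only [show (zipper p (some q) l (a :: r)).pos = p from rfl, ha, h]
  simp only [zipper, Dir.move, Cfg.mk.injEq, true_and]
  funext i
  rcases lt_trichotomy i p with hi | rfl | hi
  · rw [Function.update_of_ne hi.ne, if_pos hi, if_pos (by omega),
      show (p + 1 - 1 - i).toNat = (p - 1 - i).toNat + 1 by omega]
    simp
  · simp
  · rw [Function.update_of_ne hi.ne', if_neg (by omega), if_neg (by omega),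
      show (i - p).toNat = (i - (p + 1)).toNat + 1 by omega]
    simp

theorem step_left {q : Fin 2} {a b : Fin 4} {q' : Option (Fin 2)}
    (h : M q a = (b, Dir.L, q')) (l r : List (Fin 4)) :
    Evolves 1 (some q) l (a :: r) q' l.tail (l.headD 0 :: b :: r) := by
  intro p
  refine ⟨p - 1, ?_⟩
  have ha : (zipper p (some q) l (a :: r)).tape p = a := by simp [zipper]
  simp only [Function.iterate_one, step]
  change Cfg.mk _ _ _ = _
  simp only [show (zipper p (some q) l (a :: r)).pos = p from rfl, ha, h]
  simp only [zipper, Dir.move, Cfg.mk.injEq, true_and]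
  refine ⟨rfl, ?_⟩
  funext i
  rcases lt_trichotomy i p with hi | rfl | hi
  · rw [Function.update_of_ne hi.ne, if_pos hi]
    by_cases hi' : i < p - 1
    · rw [if_pos hi', show (p - 1 - i).toNat = (p - 1 - 1 - i).toNat + 1 by omega]
      cases l <;> simp
    · obtain rfl : i = p - 1 := by omega
      cases l <;> simp
  · simp
  · rw [Function.update_of_ne hi.ne', if_neg (by omega), if_neg (by omega),
      show (i - p).toNat = (i - (p + 1)).toNat + 1 by omega,
      show (i - (p - 1)).toNat = (i - (p + 1)).toNat + 1 + 1 by omega]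
    simp

theorem Evolves.of_blank {t : ℕ} {q q' : Option (Fin 2)} {l l' r' : List (Fin 4)}
    (h : Evolves t q l [0] q' l' r') : Evolves t q l [] q' l' r' := by
  intro p
  rw [zipper_nil]
  exact h p

theorem replicate_append_cons_self {α : Type*} (m : ℕ) (a : α) (l : List α) :
    List.replicate m a ++ a :: l = List.replicate (m + 1) a ++ l := by
  simp [List.replicate_succ']

open List in
theorem sweep_right {q : Fin 2} {a b : Fin 4} (h : M q a = (b, Dir.R, some q)) (m : ℕ)
    (l r : List (Fin 4)) :
    Evolves m (some q) l (replicate m a ++ r) (some q) (replicate m b ++ l) r := by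
  induction m generalizing l with
  | zero => exact .refl _ _ _
  | succ m ih =>
    have := (step_right h l (replicate m a ++ r)).trans (ih (b :: l))
    rw [replicate_append_cons_self] at this
    exact this.cast (by omega)

open List in
theorem sweep_left {q : Fin 2} {a b : Fin 4} (h : M q a = (b, Dir.L, some q)) (m : ℕ)
    (l r : List (Fin 4)) :
    Evolves (m + 1) (some q) (replicate m a ++ l) (a :: r)
      (some q) l.tail (l.headD 0 :: (replicate (m + 1) b ++ r)) := by
  induction m generalizing r with
  | zero => exact step_left h l r
  | succ m ih =>
    have := (step_left h (replicate (m + 1) a ++ l) r).trans (ih (b :: r))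
    rw [replicate_append_cons_self] at this
    exact this.cast (by omega)

/-- The tape to the right of the stack `1 3 ^ j`, consisting of `2 ^ m 1 ^ e`. -/
def block (m e : ℕ) : List (Fin 4) :=
  List.replicate m 2 ++ List.replicate e 1

/-- The stack `1 3 ^ j`, read from right to left. -/
def stack (j : ℕ) : List (Fin 4) :=
  List.replicate j 3 ++ [1]

/-- State `A` on the top of a stack of height `j` followed by a block evolves to the same shape
with other parameters. -/
def Pops (t j m e j' m' e' : ℕ) : Prop :=
  Evolves t (some 0) (stack j).tail ((stack j).headD 0 :: block m e)
    (some 0) (stack j').tail ((stack j').headD 0 :: block m' e')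

/-- State `A` on the blank cell to the left of a block evolves to the same shape with other
parameters. -/
def Laps (t m e m' e' : ℕ) : Prop :=
  Evolves t (some 0) [] (0 :: block m e) (some 0) [] (0 :: block m' e')

theorem pops_succ (j m e : ℕ) : Pops (2 * m + 3) (j + 1) m (e + 1) j (m + 2) e := by
  have h₁ := (step_right (q := 0) (a := 3) (by rfl) (stack j) (block m (e + 1))).trans
    (sweep_right (a := 2) (b := 1) (by rfl) m _ _)
  rw [replicate_append_cons_self] at h₁
  exact (h₁.trans (sweep_left (by rfl) (m + 1) (stack j) (List.replicate e 1))).cast (by omega)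

theorem pops_zero (j m : ℕ) : Pops (2 * m + 5) (j + 1) m 0 j (m + 1) 2 := by
  have h₁ := (step_right (q := 0) (a := 3) (by rfl) (stack j) (block m 0)).trans
    (sweep_right (a := 2) (b := 1) (by rfl) m _ _)
  rw [replicate_append_cons_self] at h₁
  have h₂ := h₁.trans (step_right (a := 0) (by rfl) _ []).of_blank
  have h₃ := h₂.trans (step_left (a := 0) (by rfl) _ []).of_blank
  have h₄ := h₃.trans (step_left (a := 1) (by rfl) _ _)
  exact (h₄.trans (sweep_left (by rfl) m (stack j) [1, 1])).cast (by omega)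

theorem Pops.refl (j m e : ℕ) : Pops 0 j m e j m e :=
  Evolves.refl _ _ _

theorem Pops.trans {s t j₁ m₁ e₁ j₂ m₂ e₂ j₃ m₃ e₃ : ℕ} (h₁ : Pops s j₁ m₁ e₁ j₂ m₂ e₂)
    (h₂ : Pops t j₂ m₂ e₂ j₃ m₃ e₃) : Pops (s + t) j₁ m₁ e₁ j₃ m₃ e₃ :=
  Evolves.trans h₁ h₂

theorem Pops.cast {s t j m e j' m' e' : ℕ} (h : Pops s j m e j' m' e') (i : s = t) :
    Pops t j m e j' m' e' :=
  i ▸ h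

theorem Laps.trans {s t m₁ e₁ m₂ e₂ m₃ e₃ : ℕ} (h₁ : Laps s m₁ e₁ m₂ e₂)
    (h₂ : Laps t m₂ e₂ m₃ e₃) : Laps (s + t) m₁ e₁ m₃ e₃ :=
  Evolves.trans h₁ h₂

theorem Laps.cast {s t m e m' e' : ℕ} (h : Laps s m e m' e') (i : s = t) : Laps t m e m' e' :=
  i ▸ h

theorem pops_triples (k r m : ℕ) :
    Pops (6 * m * k + 15 * k * k + 4 * k) (3 * k + r) m 0 r (m + 5 * k) 0 := by
  induction k generalizing m with
  | zero => simpa using Pops.refl r m 0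
  | succ k ih =>
    have h := (((pops_zero _ m).trans (pops_succ _ (m + 1) 1)).trans
      (pops_succ (3 * k + r) (m + 3) 0)).trans (ih (m + 5))
    rw [show 3 * (k + 1) + r = 3 * k + r + 1 + 1 + 1 by ring,
      show m + 5 * (k + 1) = m + 5 + 5 * k by ring]
    exact h.cast (by ring)

theorem push_block (m : ℕ) (r : List (Fin 4)) :
    Evolves (m + 1) (some 0) [] (0 :: (List.replicate m 2 ++ r)) (some 1) (stack m) r :=
  ((step_right (by rfl) [] _).trans (sweep_right (by rfl) m [1] r)).cast (by omega)

theorem push_block_one (j e : ℕ) :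
    Evolves (j + 2) (some 0) [] (0 :: block j (e + 1))
      (some 0) (stack j).tail ((stack j).headD 0 :: block 0 (e + 1)) :=
  (push_block j _).trans (step_left (by rfl) (stack j) (List.replicate e 1))

theorem pop_base (m e : ℕ) :
    Evolves 1 (some 0) (stack 0).tail ((stack 0).headD 0 :: block m e)
      (some 0) [] (0 :: block (m + 1) e) :=
  step_left (by rfl) [] (block m e)

theorem laps_of_pops {t j e m' e' : ℕ} (h : Pops t j 0 (e + 1) 0 m' e') :
    Laps (j + t + 3) j (e + 1) (m' + 1) e' :=
  (((push_block_one j e).trans h).trans (pop_base m' e')).cast (by omega)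

theorem pops_one (k r : ℕ) :
    Pops (15 * k * k + 16 * k + 3) (3 * k + r + 1) 0 1 r (5 * k + 2) 0 := by
  have h := (pops_succ (3 * k + r) 0 0).trans (pops_triples k r 2)
  rw [Nat.add_comm 2 (5 * k)] at h
  exact h.cast (by ring)

theorem pops_two (k r : ℕ) :
    Pops (15 * k * k + 28 * k + 10) (3 * k + r + 2) 0 2 r (5 * k + 4) 0 := by
  have h := ((pops_succ (3 * k + r + 1) 0 1).trans (pops_succ _ 2 0)).trans (pops_triples k r 4)
  rw [Nat.add_comm 4 (5 * k)] at h
  exact h.cast (by ring)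

theorem laps_one_zero (k : ℕ) :
    Laps (15 * k * k + 19 * k + 7) (3 * k + 1) 1 (5 * k + 3) 0 :=
  (laps_of_pops (pops_one k 0)).cast (by ring)

theorem laps_one_one (k : ℕ) :
    Laps (15 * k * k + 29 * k + 17) (3 * k + 2) 1 (5 * k + 4) 2 :=
  (laps_of_pops ((pops_one k 1).trans (pops_zero 0 _))).cast (by ring)

theorem laps_one_two (k : ℕ) :
    Laps (15 * k * k + 39 * k + 27) (3 * k + 3) 1 (5 * k + 6) 1 :=
  (laps_of_pops (((pops_one k 2).trans (pops_zero 1 _)).trans (pops_succ 0 _ 1))).cast (by ring)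

theorem laps_two_one (k : ℕ) :
    Laps (15 * k * k + 41 * k + 29) (3 * k + 3) 2 (5 * k + 6) 2 :=
  (laps_of_pops ((pops_two k 1).trans (pops_zero 0 _))).cast (by ring)

theorem laps_two_two (k : ℕ) :
    Laps (15 * k * k + 51 * k + 43) (3 * k + 4) 2 (5 * k + 8) 1 :=
  (laps_of_pops (((pops_two k 2).trans (pops_zero 1 _)).trans (pops_succ 0 _ 1))).cast (by ring)

theorem laps_champion : Laps 3930907 1 2 2048 0 := by
  have h₁ : Laps 7 1 2 3 1 := laps_of_pops (pops_succ 0 0 1)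
  have h₂ := (h₁.trans (laps_one_two 0)).trans (laps_one_two 1)
  have h₃ := ((h₂.trans (laps_one_one 3)).trans (laps_two_two 5)).trans (laps_one_two 10)
  have h₄ := ((h₃.trans (laps_one_one 18)).trans (laps_two_two 30)).trans (laps_one_one 52)
  have h₅ := ((h₄.trans (laps_two_one 87)).trans (laps_two_one 146)).trans (laps_two_two 244)
  exact (h₅.trans (laps_one_zero 409)).cast (by norm_num)

theorem evolves_start : Evolves 6 (some 0) [] [] (some 0) [] (0 :: block 1 2) := by
  have h₁ := (step_right (q := 0) (a := 0) (by rfl) [] []).of_blank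
  have h₂ := (h₁.trans (step_left (a := 0) (by rfl) _ []).of_blank).trans
    (step_left (a := 1) (by rfl) _ _)
  have h₃ := (h₂.trans (step_right (a := 0) (by rfl) _ _)).trans (step_left (a := 1) (by rfl) _ _)
  exact h₃.trans (step_left (a := 1) (by rfl) _ _)

theorem evolves_last :
    Evolves 3932963 (some 0) [] [] (some 1) (stack 2048).tail [3, 1] :=
  (((evolves_start.trans laps_champion).trans (push_block 2048 _)).trans
    (step_left (a := 0) (by rfl) (stack 2048) []).of_blank).cast (by norm_num)

theorem evolves_halt : Evolves 3932964 (some 0) [] [] none (1 :: (stack 2048).tail) [1] :=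
  (evolves_last.trans (step_right (by rfl) _ _)).cast (by norm_num)

theorem init_eq_zipper : init 2 4 = zipper 0 (some 0) [] [] := by
  simp [init, zipper]

theorem sigmaCount_zipper (p : ℤ) (q : Option (Fin 2)) {l r : List (Fin 4)}
    (hl : ∀ a ∈ l, a ≠ 0) (hr : ∀ a ∈ r, a ≠ 0) :
    sigmaCount (zipper p q l r) = l.length + r.length := by
  have getD_ne {s : List (Fin 4)} (hs : ∀ a ∈ s, a ≠ 0) (k : ℕ) :
      s.getD k 0 ≠ 0 ↔ k < s.length := by
    constructor
    · intro h
      by_contra! hk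
      exact h (List.getD_eq_default _ _ hk)
    · intro hk
      rw [List.getD_eq_getElem _ _ hk]
      exact hs _ (List.getElem_mem hk)
  have : {i : ℤ | (zipper p q l r).tape i ≠ 0} =
      ↑(Finset.Ico (p - l.length) (p + r.length)) := by
    ext i
    simp only [zipper, Set.mem_ofPred_eq, Finset.coe_Ico, Set.mem_Ico]
    split_ifs with hi
    · rw [getD_ne hl]
      omega
    · rw [getD_ne hr]
      omega
  rw [sigmaCount, this, Set.ncard_coe_finset, Int.card_Ico]
  omega

theorem iterate_step_of_halted {n k : ℕ} (N : Machine n k) {c : Cfg n k} (h : c.state = none)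
    (t : ℕ) : (step N)^[t] c = c :=
  Function.iterate_fixed (by simp [step, h]) t

theorem haltsIn_of_eq_succ {n k : ℕ} {N : Machine n k} {c : Cfg n k} {s t : ℕ} (hst : t = s + 1)
    (h : ((step N)^[s] c).state ≠ none) (h' : ((step N)^[t] c).state = none) :
    HaltsIn N c t := by
  refine ⟨h', fun i hi hn => h ?_⟩
  obtain ⟨d, rfl⟩ := Nat.exists_eq_add_of_le' (Nat.le_of_lt_succ (hst ▸ hi))
  rwa [Function.iterate_add_apply, iterate_step_of_halted N hn]

theorem HaltsIn.unique {n k : ℕ} {N : Machine n k} {c : Cfg n k} {s t : ℕ}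
    (hs : HaltsIn N c s) (ht : HaltsIn N c t) : s = t := by
  rcases lt_trichotomy s t with h | h | h
  · exact absurd hs.1 (ht.2 s h)
  · exact h
  · exact absurd ht.1 (hs.2 t h)

instance : Finite Dir :=
  Finite.of_surjective (fun b : Bool => if b then Dir.R else Dir.L)
    (by rintro (_ | _); exacts [⟨false, rfl⟩, ⟨true, rfl⟩])

theorem bddAbove_haltingTimes (n k : ℕ) [NeZero k] :
    BddAbove {t : ℕ | ∃ N : Machine n k, Valid N ∧ HaltsIn N (init n k) t} := by
  refine Set.Finite.bddAbove ?_
  rw [Set.ofPred_exists]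
  exact Set.finite_iUnion fun N =>
    Set.Subsingleton.finite fun s hs t ht => hs.2.unique ht.2

theorem bddAbove_haltingScores (n k : ℕ) [NeZero k] :
    BddAbove {m : ℕ | ∃ N : Machine n k, Valid N ∧
      ∃ t : ℕ, HaltsIn N (init n k) t ∧ sigmaCount ((step N)^[t] (init n k)) = m} := by
  refine Set.Finite.bddAbove ?_
  rw [Set.ofPred_exists]
  refine Set.finite_iUnion fun N => Set.Subsingleton.finite ?_
  rintro _ ⟨-, s, hs, rfl⟩ _ ⟨-, t, ht, rfl⟩
  rw [hs.unique ht]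

theorem valid_M : Valid M := by
  intro q a h
  fin_cases q <;> fin_cases a <;> simp [M] at h ⊢

/-- Started on the all-blank tape, the Ligockis' 2-state 4-symbol champion halts after
exactly 3,932,964 steps leaving exactly 2,050 non-blank cells; hence
`S(2,4) ≥ 3,932,964` and `Σ(2,4) ≥ 2,050`. -/
theorem ligocki_24_champion :
    HaltsIn M (init 2 4) 3932964 ∧
    sigmaCount ((step M)^[3932964] (init 2 4)) = 2050 ∧
    3932964 ≤ bbS 2 4 ∧ 2050 ≤ bbSigma 2 4 := by
  obtain ⟨p, hp⟩ := evolves_last 0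
  obtain ⟨p', hp'⟩ := evolves_halt 0
  rw [← init_eq_zipper] at hp hp'
  have hhalts : HaltsIn M (init 2 4) 3932964 :=
    haltsIn_of_eq_succ (s := 3932963) (by norm_num) (by rw [hp]; simp [zipper]) (by rw [hp']; rfl)
  have hsigma : sigmaCount ((step M)^[3932964] (init 2 4)) = 2050 := by
    rw [hp', sigmaCount_zipper]
    · simp only [stack, List.length_cons, List.length_tail, List.length_append, List.length_replicate,
        List.length_nil]
    · intro a ha
      rcases List.mem_cons.1 ha with rfl | ha
      · decide
      · have := List.mem_of_mem_tail ha
        simp only [stack, List.mem_append, List.mem_replicate, List.mem_singleton] at this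
        rcases this with ⟨-, rfl⟩ | rfl <;> decide
    · decide
  exact ⟨hhalts, hsigma, le_csSup (bddAbove_haltingTimes 2 4) ⟨M, valid_M, hhalts⟩,
    le_csSup (bddAbove_haltingScores 2 4) ⟨M, valid_M, _, hhalts, hsigma⟩⟩
end

section
/- For the 2-state 4-symbol Turing machine M with transition table δ(A,0)=(1,R,B), δ(A,1)=(2,L,A), δ(A,2)=(1,R,A), δ(A,3)=(1,R,A), δ(B,0)=(1,L,B), δ(B,1)=(1,L,A), δ(B,2)=(3,R,B), δ(B,3)=(1,R,H): started in state A on the all-blank tape the machine reaches a configuration C(1,2) in exactly 6 steps; and for every natural number k: from any configuration C(3k,1) it reaches C(5k+1,1) in exactly 15k²+9k+3 steps; from C(3k+1,1) it halts in exactly 15k²+24k+13 steps, the final tape reading left to right (all other cells blank): 1, then 5k+2 cells containing 3, then 1, with the halted head scanning a final cell containing 1; from C(3k+2,1) it reaches C(5k+4,2) in exactly 15k²+29k+17 steps; from C(3k,2) it reaches C(5k+1,2) in exactly 15k²+11k+3 steps; from C(3k+1,2) it reaches C(5k+3,1) in exactly 15k²+21k+7 steps; and from C(3k+2,2) it halts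 in exactly 15k²+36k+23 steps, the final tape reading left to right (all other cells blank): 1, then 5k+4 cells containing 3, then 1, with the halted head scanning a final cell containing 1. -/
/-- The configuration `C(n,m)` (for `m = 1` or `m = 2`) with head at cell `p`: state `A`,
scanned cell blank, the `n` cells immediately to the right of the head contain `2`
followed by `m` cells containing `1`, all other cells blank. -/
def Cf (n m : ℕ) (p : ℤ) : Cfg 2 4 :=
  { state := some 0
    pos := p
    tape := fun i =>
      if p < i ∧ i ≤ p + n then 2
      else if p + n < i ∧ i ≤ p + n + m then 1
      else 0 }

/-- The configuration in state `q` with the head at cell `p`, where `l` lists the cells left of the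
head (nearest first), `r` lists the scanned cell and those right of it, and the rest is blank. -/
def zip (q : Option (Fin 2)) (l r : List (Fin 4)) (p : ℤ) : Cfg 2 4 where
  state := q
  pos := p
  tape i := if p ≤ i then r.getD (i - p).toNat 0 else l.getD (p - 1 - i).toNat 0

theorem zip_right_nil (q : Option (Fin 2)) (l : List (Fin 4)) (p : ℤ) :
    zip q l [] p = zip q l [0] p := by
  simp only [zip, Cfg.mk.injEq, true_and]
  funext i
  rcases (i - p).toNat with _ | n <;> simp

theorem zip_left_append_blank (q : Option (Fin 2)) (l r : List (Fin 4)) (p : ℤ) :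
    zip q l r p = zip q (l ++ [0]) r p := by
  simp only [zip, Cfg.mk.injEq, true_and]
  funext i
  congr 1
  rcases lt_trichotomy (p - 1 - i).toNat l.length with h | h | h
  · rw [List.getD_append _ _ _ _ h]
  · simp [h]
  · rw [List.getD_eq_default _ _ h.le, List.getD_eq_default _ _ (by simpa using h)]

theorem step_zip_right {q : Fin 2} {a b : Fin 4} {q' : Option (Fin 2)}
    (h : M q a = (b, Dir.R, q')) (l r : List (Fin 4)) (p : ℤ) :
    step M (zip (some q) l (a :: r) p) = zip q' (b :: l) r (p + 1) := by
  simp only [step, zip, le_refl, if_true, sub_self, Int.toNat_zero, List.getD_cons_zero, h,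
    Dir.move, Cfg.mk.injEq, true_and]
  funext i
  rcases lt_trichotomy i p with hi | rfl | hi
  · have e : (p - i).toNat = (p - 1 - i).toNat + 1 := by omega
    simp [Function.update_of_ne hi.ne, not_le.2 hi, show ¬ p + 1 ≤ i by omega, e]
  · simp
  · have e : (i - p).toNat = (i - (p + 1)).toNat + 1 := by omega
    simp [Function.update_of_ne hi.ne', hi.le, show p + 1 ≤ i by omega, e]

theorem step_zip_left {q : Fin 2} {a b : Fin 4} {q' : Option (Fin 2)}
    (h : M q a = (b, Dir.L, q')) (c : Fin 4) (l r : List (Fin 4)) (p : ℤ) :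
    step M (zip (some q) (c :: l) (a :: r) p) = zip q' l (c :: b :: r) (p - 1) := by
  simp only [step, zip, le_refl, if_true, sub_self, Int.toNat_zero, List.getD_cons_zero, h,
    Dir.move, Cfg.mk.injEq, true_and]
  refine ⟨by ring, ?_⟩
  funext i
  rcases lt_trichotomy i p with hi | rfl | hi
  · rcases (show i ≤ p - 1 by omega).lt_or_eq with hi' | rfl
    · have e : (p - 1 - i).toNat = (p - 1 - 1 - i).toNat + 1 := by omega
      simp [Function.update_of_ne hi.ne, not_le.2 hi, show ¬ p ≤ i + 1 by omega, e]
    · simp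
  · simp
  · have e : (i - p).toNat = (i - (p + 1)).toNat + 1 := by omega
    have e' : (i - (p - 1)).toNat = (i - (p + 1)).toNat + 2 := by omega
    simp [Function.update_of_ne hi.ne', hi.le, show p ≤ i + 1 by omega, e, e']

/-- In exactly `t` steps, `f` at any head position leads to `g` at some head position. -/
def Reaches (t : ℕ) (f g : ℤ → Cfg 2 4) : Prop :=
  ∀ p, ∃ q, (step M)^[t] (f p) = g q

theorem Reaches.trans {s t : ℕ} {f g h : ℤ → Cfg 2 4} (hfg : Reaches s f g)
    (hgh : Reaches t g h) : Reaches (s + t) f h := by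
  intro p
  obtain ⟨q, hq⟩ := hfg p
  obtain ⟨r, hr⟩ := hgh q
  exact ⟨r, by rw [add_comm, Function.iterate_add_apply, hq, hr]⟩

theorem Reaches.of_eq {s t : ℕ} {f g g' : ℤ → Cfg 2 4} (h : Reaches s f g) (hst : s = t)
    (hg : g = g') : Reaches t f g' := hst ▸ hg ▸ h

theorem Reaches.refl (f : ℤ → Cfg 2 4) : Reaches 0 f f := fun p => ⟨p, rfl⟩

theorem reaches_right {q : Fin 2} {a b : Fin 4} {q' : Option (Fin 2)}
    (h : M q a = (b, Dir.R, q')) (l r : List (Fin 4)) :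
    Reaches 1 (zip (some q) l (a :: r)) (zip q' (b :: l) r) :=
  fun p => ⟨_, step_zip_right h l r p⟩

theorem reaches_left {q : Fin 2} {a b : Fin 4} {q' : Option (Fin 2)}
    (h : M q a = (b, Dir.L, q')) (c : Fin 4) (l r : List (Fin 4)) :
    Reaches 1 (zip (some q) (c :: l) (a :: r)) (zip q' l (c :: b :: r)) :=
  fun p => ⟨_, step_zip_left h c l r p⟩

theorem replicate_append_cons (n : ℕ) (a : Fin 4) (l : List (Fin 4)) :
    List.replicate n a ++ a :: l = a :: (List.replicate n a ++ l) := by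
  rw [← List.cons_append, ← List.replicate_succ, List.replicate_succ', List.append_assoc]
  rfl

theorem reaches_right_sweep {q : Fin 2} {a b : Fin 4} (h : M q a = (b, Dir.R, some q))
    (n : ℕ) (l r : List (Fin 4)) :
    Reaches n (zip (some q) l (List.replicate n a ++ r))
      (zip (some q) (List.replicate n b ++ l) r) := by
  induction n generalizing l with
  | zero => exact Reaches.refl _
  | succ n ih =>
    have := (reaches_right h l (List.replicate n a ++ r)).trans (ih (b :: l))
    rw [replicate_append_cons] at this
    exact this.of_eq (add_comm _ _) rfl

theorem reaches_left_sweep {q : Fin 2} {a b : Fin 4} (h : M q a = (b, Dir.L, some q))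
    (n : ℕ) (c : Fin 4) (l r : List (Fin 4)) :
    Reaches (n + 1) (zip (some q) (List.replicate n a ++ c :: l) (a :: r))
      (zip (some q) l (c :: (List.replicate (n + 1) b ++ r))) := by
  induction n generalizing r with
  | zero => exact reaches_left h c l r
  | succ n ih =>
    have := (reaches_left h a (List.replicate n a ++ c :: l) r).trans (ih (b :: r))
    rw [replicate_append_cons] at this
    exact this.of_eq (add_comm _ _) rfl

theorem Cf_eq_zip (n m : ℕ) :
    Cf n m = zip (some 0) [] (0 :: (List.replicate n 2 ++ List.replicate m 1)) := by
  funext p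
  simp only [Cf, zip, Cfg.mk.injEq, true_and]
  funext i
  rcases lt_trichotomy i p with hi | rfl | hi
  · simp [show ¬ p ≤ i by omega, show ¬ p < i by omega, show ¬ p + n < i by omega]
  · simp
  · have e : (i - p).toNat = (i - p - 1).toNat + 1 := by omega
    rw [if_pos hi.le, e, List.getD_cons_succ]
    by_cases h₁ : i ≤ p + n
    · rw [if_pos ⟨hi, h₁⟩, List.getD_append _ _ _ _ (by simp; omega),
        List.getD_replicate]
      omega
    · rw [if_neg (by omega), List.getD_append_right _ _ _ _ (by simp; omega),
        List.length_replicate]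
      by_cases h₂ : i ≤ p + n + m
      · rw [if_pos (by omega), List.getD_replicate]
        omega
      · rw [if_neg (by omega), List.getD_eq_default _ _ (by simp; omega)]

/-- The configurations `1 3^j A> 3 2^m 1^r` at which the zigzags of `M` turn around. -/
def turn (j m r : ℕ) : ℤ → Cfg 2 4 :=
  zip (some 0) (List.replicate j 3 ++ [1])
    (3 :: (List.replicate m 2 ++ List.replicate r 1))

theorem Cf_reaches_turn (n r : ℕ) : Reaches (n + 3) (Cf (n + 1) (r + 1)) (turn n 0 (r + 1)) := by
  rw [Cf_eq_zip]
  refine ((reaches_right (q' := some 1) rfl _ _).trans ((reaches_right_sweep rfl _ _ _).trans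
    (reaches_left (q' := some 0) rfl _ _ _))).of_eq ?_ rfl
  omega

theorem turn_right (l r : List (Fin 4)) (m : ℕ) :
    Reaches (m + 1) (zip (some 0) l (3 :: (List.replicate m 2 ++ r)))
      (zip (some 0) (List.replicate (m + 1) 1 ++ l) r) := by
  have := (reaches_right (q := 0) (a := 3) rfl l (List.replicate m 2 ++ r)).trans
    (reaches_right_sweep rfl m (1 :: l) r)
  rw [replicate_append_cons] at this
  exact this.of_eq (add_comm _ _) rfl

theorem turn_right_blank (l : List (Fin 4)) (m : ℕ) :
    Reaches (m + 4) (zip (some 0) l (3 :: (List.replicate m 2 ++ [])))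
      (zip (some 0) (List.replicate m 1 ++ l) [1, 1, 1]) := by
  have h := turn_right l [] m
  rw [funext (zip_right_nil _ (List.replicate (m + 1) 1 ++ l))] at h
  have h' := reaches_right (q := 0) (a := 0) rfl (List.replicate (m + 1) 1 ++ l) []
  rw [funext (zip_right_nil _ (_ :: _))] at h'
  exact ((h.trans h').trans ((reaches_left (q := 1) (a := 0) rfl _ _ _).trans
    (reaches_left (q := 1) (a := 1) rfl _ _ _))).of_eq rfl rfl

theorem turn_succ_succ (j m r : ℕ) :
    Reaches (2 * m + 3) (turn (j + 1) m (r + 1)) (turn j (m + 2) r) :=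
  ((turn_right _ _ _).trans (reaches_left_sweep (q := 0) (a := 1) rfl (m + 1) 3
    (List.replicate j 3 ++ [1]) (List.replicate r 1))).of_eq (by ring) rfl

theorem turn_zero_eq (m r : ℕ) : turn 0 m r = zip (some 0) [1, 0]
    (3 :: (List.replicate m 2 ++ List.replicate r 1)) :=
  funext (zip_left_append_blank _ _ _)

theorem turn_zero_succ (m r : ℕ) :
    Reaches (2 * m + 4) (turn 0 m (r + 1)) (Cf (m + 3) r) := by
  rw [turn_zero_eq, Cf_eq_zip]
  have h := turn_right [1, 0] (List.replicate (r + 1) 1) m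
  rw [replicate_append_cons] at h
  exact (h.trans (reaches_left_sweep (q := 0) (a := 1) rfl (m + 2) 0 []
    (List.replicate r 1))).of_eq (by ring) rfl

theorem turn_succ_zero (j m : ℕ) :
    Reaches (2 * m + 5) (turn (j + 1) m 0) (turn j (m + 1) 2) :=
  ((turn_right_blank _ _).trans (reaches_left_sweep (q := 0) (a := 1) rfl m 3
    (List.replicate j 3 ++ [1]) [1, 1])).of_eq (by ring) rfl

theorem turn_zero_zero (m : ℕ) :
    Reaches (2 * m + 6) (turn 0 m 0) (Cf (m + 2) 2) := by
  rw [turn_zero_eq, Cf_eq_zip]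
  have h := turn_right_blank [1, 0] m
  rw [replicate_append_cons] at h
  exact (h.trans (reaches_left_sweep (q := 0) (a := 1) rfl (m + 1) 0 [] [1, 1])).of_eq
    (by ring) rfl

theorem turn_cycle (k j m : ℕ) :
    Reaches (15 * k ^ 2 + 8 * k + 6 * m * k) (turn (3 * k + j) m 2) (turn j (m + 5 * k) 2) := by
  induction k generalizing m with
  | zero => exact (Reaches.refl _).of_eq (by ring) (by simp)
  | succ k ih =>
    have := (turn_succ_succ (3 * k + j + 2) m 1).trans
      ((turn_succ_succ (3 * k + j + 1) (m + 2) 0).trans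
        ((turn_succ_zero (3 * k + j) (m + 4)).trans (ih (m + 5))))
    rw [show 3 * (k + 1) + j = 3 * k + j + 2 + 1 by ring]
    exact this.of_eq (by ring) (by congr 1; ring)

theorem turn_one_cycle (k j : ℕ) :
    Reaches (15 * k ^ 2 + 26 * k + 12) (turn (3 * k + j + 2) 0 1) (turn j (5 * k + 3) 2) :=
  ((turn_succ_succ (3 * k + j + 1) 0 0).trans ((turn_succ_zero (3 * k + j) 2).trans
    (turn_cycle k j 3))).of_eq (by ring) (by congr 1; ring)

theorem Cf_zero_reaches (r : ℕ) : Reaches 3 (Cf 0 (r + 1)) (Cf 1 (r + 1)) := by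
  rw [Cf_eq_zip, Cf_eq_zip]
  have h := (reaches_right (q := 0) (a := 0) rfl [] (List.replicate (r + 1) 1)).trans
    (reaches_left (q := 1) (a := 1) rfl 1 [] (List.replicate r 1))
  rw [funext (zip_left_append_blank _ [] (1 :: 1 :: _))] at h
  exact h.trans (reaches_left (q := 0) (a := 1) rfl 0 [] _)

theorem init_reaches : ∃ q, (step M)^[6] (init 2 4) = Cf 1 2 q := by
  have h := reaches_right (q := 0) (a := 0) rfl [] []
  rw [funext (zip_right_nil _ [1])] at h
  have h' := h.trans (reaches_left (q := 1) (a := 0) rfl 1 [] [])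
  rw [funext (zip_left_append_blank _ [] [1, 1])] at h'
  have h'' := (h'.trans (reaches_left (q := 1) (a := 1) rfl 0 [] [1])).of_eq rfl
    (Cf_eq_zip 0 2).symm
  have e : init 2 4 = zip (some 0) [] [0] 0 := by
    rw [← zip_right_nil]
    simp [init, zip]
  rw [e]
  exact h''.trans (Cf_zero_reaches 1) 0

theorem state_ne_none_of_le {n k : ℕ} {T : Machine n k} {c : Cfg n k} {s t : ℕ} (hst : s ≤ t)
    (ht : ((step T)^[t] c).state ≠ none) : ((step T)^[s] c).state ≠ none := by
  induction hst with
  | refl => exact ht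
  | step _ ih =>
    refine ih fun h => ht ?_
    rw [Function.iterate_succ_apply', step, h]
    exact h

theorem Cf_reaches_halt (n : ℕ) : Reaches (n + 3) (Cf (n + 1) 0)
    (zip (some 1) (List.replicate n 3 ++ [1]) [3, 1]) := by
  rw [Cf_eq_zip]
  have h := (reaches_right (q := 0) (a := 0) rfl [] _).trans
    (reaches_right_sweep (q := 1) (a := 2) rfl (n + 1) [1] [])
  rw [funext (zip_right_nil _ _)] at h
  exact (h.trans (reaches_left (q := 1) (a := 0) rfl 3 _ _)).of_eq (by ring) rfl

theorem haltsIn_of_reaches {t n s k : ℕ} {f : ℤ → Cfg 2 4} {a b c : ℤ}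
    (h : Reaches t f (Cf (n + 1) 0)) (hs : t + n + 4 = s) (hn : (n : ℤ) = 5 * k + a)
    (hb : a + 1 = b) (hc : a + 2 = c) (p : ℤ) :
    HaltsIn M (f p) s ∧ ∃ q : ℤ, (step M)^[s] (f p) =
      { state := none
        pos := q + 5 * k + c
        tape := fun i =>
          if i = q ∨ i = q + 5 * k + b ∨ i = q + 5 * k + c then 1
          else if q + 1 ≤ i ∧ i ≤ q + 5 * k + a then 3 else 0 } := by
  subst hs hb hc
  obtain ⟨q, hq⟩ := (h.trans (Cf_reaches_halt n)) p
  have hq' : (step M)^[t + n + 4] (f p) =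
      zip none (1 :: (List.replicate n 3 ++ [1])) [1] (q + 1) := by
    rw [show t + n + 4 = (t + (n + 3)) + 1 by ring, Function.iterate_succ_apply', hq]
    exact step_zip_right rfl _ _ _
  refine ⟨⟨by rw [hq']; rfl, fun i hi => state_ne_none_of_le (t := t + (n + 3)) (by omega) ?_⟩,
    q - n - 1, ?_⟩
  · rw [hq]
    exact Option.some_ne_none _
  · rw [hq']
    simp only [zip, Cfg.mk.injEq, true_and]
    refine ⟨by omega, ?_⟩
    funext i
    split_ifs with h₁ h₂ h₃ h₄ h₅
    · rw [show (i - (q + 1)).toNat = 0 by omega]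
      rfl
    · omega
    · rw [List.getD_eq_default _ _ (by simp; omega)]
    · rcases h₄ with h₄ | h₄ | h₄
      · rw [show (q + 1 - 1 - i).toNat = n + 1 by omega, List.getD_cons_succ,
          List.getD_append_right _ _ _ _ (by simp)]
        simp
      · rw [show (q + 1 - 1 - i).toNat = 0 by omega]
        rfl
      · omega
    · obtain ⟨d, hd⟩ : ∃ d, (q + 1 - 1 - i).toNat = d + 1 := ⟨(q - i - 1).toNat, by omega⟩
      rw [hd, List.getD_cons_succ, List.getD_append _ _ _ _ (by simp; omega),
        List.getD_replicate]
      omega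
    · rw [List.getD_eq_default _ _ (by simp; omega)]

/-- Michel's analysis of the Ligockis' 2-state 4-symbol champion: the blank tape leads to
`C(1,2)` in 6 steps; `C(3k,1) ⊢(15k²+9k+3) C(5k+1,1)`; from `C(3k+1,1)` the machine halts
in exactly `15k²+24k+13` steps with final tape `…0 1 3^{5k+2} 1 (H1) 0…`;
`C(3k+2,1) ⊢(15k²+29k+17) C(5k+4,2)`; `C(3k,2) ⊢(15k²+11k+3) C(5k+1,2)`;
`C(3k+1,2) ⊢(15k²+21k+7) C(5k+3,1)`; and from `C(3k+2,2)` it halts in exactly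
`15k²+36k+23` steps with final tape `…0 1 3^{5k+4} 1 (H1) 0…`. -/
theorem ligocki_24_champion_analysis :
    (∃ q : ℤ, (step M)^[6] (init 2 4) = Cf 1 2 q) ∧
    ∀ k : ℕ, ∀ p : ℤ,
      (∃ q : ℤ, (step M)^[15 * k ^ 2 + 9 * k + 3] (Cf (3 * k) 1 p) =
        Cf (5 * k + 1) 1 q) ∧
      (HaltsIn M (Cf (3 * k + 1) 1 p) (15 * k ^ 2 + 24 * k + 13) ∧
        ∃ q : ℤ, (step M)^[15 * k ^ 2 + 24 * k + 13] (Cf (3 * k + 1) 1 p) =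
          { state := none
            pos := q + 5 * k + 4
            tape := fun i =>
              if i = q ∨ i = q + 5 * k + 3 ∨ i = q + 5 * k + 4 then 1
              else if q + 1 ≤ i ∧ i ≤ q + 5 * k + 2 then 3 else 0 }) ∧
      (∃ q : ℤ, (step M)^[15 * k ^ 2 + 29 * k + 17] (Cf (3 * k + 2) 1 p) =
        Cf (5 * k + 4) 2 q) ∧
      (∃ q : ℤ, (step M)^[15 * k ^ 2 + 11 * k + 3] (Cf (3 * k) 2 p) =
        Cf (5 * k + 1) 2 q) ∧
      (∃ q : ℤ, (step M)^[15 * k ^ 2 + 21 * k + 7] (Cf (3 * k + 1) 2 p) =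
        Cf (5 * k + 3) 1 q) ∧
      (HaltsIn M (Cf (3 * k + 2) 2 p) (15 * k ^ 2 + 36 * k + 23) ∧
        ∃ q : ℤ, (step M)^[15 * k ^ 2 + 36 * k + 23] (Cf (3 * k + 2) 2 p) =
          { state := none
            pos := q + 5 * k + 6
            tape := fun i =>
              if i = q ∨ i = q + 5 * k + 5 ∨ i = q + 5 * k + 6 then 1
              else if q + 1 ≤ i ∧ i ≤ q + 5 * k + 4 then 3 else 0 }) := by
  refine ⟨init_reaches, fun k p => ⟨?_, ?_, ?_, ?_, ?_, ?_⟩⟩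
  · rcases k with _ | k
    · exact Cf_zero_reaches 0 p
    · exact ((Cf_reaches_turn (3 * k + 2) 0).trans ((turn_one_cycle k 0).trans
        (turn_zero_succ _ 1))).of_eq (by ring) (by congr 1) p
  · rcases k with _ | k
    · exact haltsIn_of_reaches (k := 0) (a := 2)
        ((Cf_reaches_turn 0 0).trans (turn_zero_succ 0 0)) rfl rfl rfl rfl p
    · refine haltsIn_of_reaches (k := k + 1) (a := 2) ((Cf_reaches_turn (3 * k + 3) 0).trans
        ((turn_one_cycle k 1).trans ((turn_succ_succ 0 _ 1).trans (turn_zero_succ _ 0))))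
        ?_ (by push_cast; ring) rfl rfl p
      ring
  · rcases k with _ | k
    · exact ((Cf_reaches_turn 1 0).trans ((turn_succ_succ 0 0 0).trans (turn_zero_zero 2))) p
    · exact ((Cf_reaches_turn (3 * k + 4) 0).trans ((turn_one_cycle k 2).trans
        ((turn_succ_succ 1 _ 1).trans ((turn_succ_succ 0 _ 0).trans
          (turn_zero_zero _))))).of_eq (by ring) (by congr 1) p
  · rcases k with _ | k
    · exact Cf_zero_reaches 1 p
    · exact ((Cf_reaches_turn (3 * k + 2) 1).trans ((turn_cycle k 2 0).trans
        ((turn_succ_succ 1 _ 1).trans ((turn_succ_succ 0 _ 0).trans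
          (turn_zero_zero _))))).of_eq (by ring) (by congr 1; ring) p
  · exact ((Cf_reaches_turn (3 * k) 1).trans ((turn_cycle k 0 0).trans
      (turn_zero_succ _ 1))).of_eq (by ring) (by congr 1; ring) p
  · refine haltsIn_of_reaches (k := k) (a := 4) ((Cf_reaches_turn (3 * k + 1) 1).trans
      ((turn_cycle k 1 0).trans ((turn_succ_succ 0 _ 1).trans (turn_zero_succ _ 0))))
      ?_ (by push_cast; ring) rfl rfl p
    ring
end
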